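/- arXiv:1009.3147 — 2 statements merged into one kernel-verified Lean document; each statement's English description precedes it below -/
import Mathlib

section
/- For every natural number ℓ there exists a constant C > 0, depending only on ℓ, such that for every L > 0 and every real polynomial p of degree at most ℓ one has |p(0) − L^{-1} ∫₀^L p(t) dt|² ≤ C · ∫₀^L ∫₀^L (p(s) − p(t))²/(s − t)² ds dt. -/
open intervalIntegral

/-- The vanishing of the `(ℓ + 1)`-st finite difference expresses the value at `0` through the
values at `x, 2x, …, (ℓ + 1)x`. -/
theorem Polynomial.exists_sq_eval_zero_le_sum (ℓ : ℕ) :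
    ∃ A > (0 : ℝ), ∀ q : Polynomial ℝ, q.natDegree ≤ ℓ → ∀ x : ℝ,
      q.eval 0 ^ 2 ≤ A * ∑ k ∈ Finset.range (ℓ + 1), q.eval ((k + 1 : ℝ) * x) ^ 2 := by
  set c : ℕ → ℝ := fun k => (-1) ^ (ℓ + 1 - (k + 1)) * ((ℓ + 1).choose (k + 1) : ℝ)
  refine ⟨∑ k ∈ Finset.range (ℓ + 1), c k ^ 2 + 1, by positivity, fun q hq x => ?_⟩
  have hdeg : (q.comp (C x * X)).natDegree < ℓ + 1 := by
    have h1 := Polynomial.natDegree_comp_le (p := q) (q := C x * X)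
    have h2 : (C x * X : Polynomial ℝ).natDegree ≤ 1 :=
      (Polynomial.natDegree_C_mul_le x X).trans Polynomial.natDegree_X_le
    have h3 := Nat.mul_le_mul hq h2
    omega
  have h := congrFun (Polynomial.fwdDiff_iter_eq_zero_of_degree_lt hdeg) 0
  rw [fwdDiff_iter_eq_sum_shift, Finset.sum_range_succ'] at h
  have hsum : (-1) ^ (ℓ + 1) * q.eval 0 =
      -∑ k ∈ Finset.range (ℓ + 1), c k * q.eval ((k + 1 : ℝ) * x) := by
    rw [eq_neg_iff_add_eq_zero, add_comm]
    simpa [c, mul_comm x] using h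
  have hsq : q.eval 0 ^ 2 =
      (∑ k ∈ Finset.range (ℓ + 1), c k * q.eval ((k + 1 : ℝ) * x)) ^ 2 := by
    rw [← neg_sq (∑ k ∈ _, _), ← hsum, mul_pow, ← pow_mul, mul_comm (ℓ + 1) 2, pow_mul]
    norm_num
  rw [hsq]
  refine (Finset.sum_mul_sq_le_sq_mul_sq _ _ _).trans ?_
  gcongr
  linarith

/-- Scaled polynomial trace inequality. -/
theorem Polynomial.exists_mul_sq_eval_zero_le_integral (ℓ : ℕ) :
    ∃ A > (0 : ℝ), ∀ L > (0 : ℝ), ∀ q : Polynomial ℝ, q.natDegree ≤ ℓ →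
      L * q.eval 0 ^ 2 ≤ A * ∫ t in (0 : ℝ)..L, q.eval t ^ 2 := by
  obtain ⟨A, hA, h⟩ := Polynomial.exists_sq_eval_zero_le_sum ℓ
  refine ⟨A * (ℓ + 1) ^ 2, by positivity, fun L hL q hq => ?_⟩
  have hcont : Continuous fun t => q.eval t ^ 2 := by fun_prop
  have hn : (0 : ℝ) < ℓ + 1 := by positivity
  set M : ℝ := L / (ℓ + 1) with hM
  have hM0 : 0 < M := by positivity
  have hterm : ∀ k ∈ Finset.range (ℓ + 1),
      ∫ x in (0 : ℝ)..M, q.eval ((k + 1 : ℝ) * x) ^ 2 ≤ ∫ t in (0 : ℝ)..L, q.eval t ^ 2 := by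
    intro k hk
    have hk1 : (0 : ℝ) < k + 1 := by positivity
    have hkl : (k : ℝ) + 1 ≤ ℓ + 1 := by
      exact_mod_cast Finset.mem_range.mp hk
    have hkM : ((k : ℝ) + 1) * M ≤ L := by
      rw [hM, mul_div_assoc', div_le_iff₀ hn, mul_comm L]
      gcongr
    rw [integral_comp_mul_left (fun t => q.eval t ^ 2) hk1.ne', mul_zero, smul_eq_mul]
    have h0 : 0 ≤ ∫ t in (0 : ℝ)..(k + 1) * M, q.eval t ^ 2 :=
      integral_nonneg (by positivity) fun t _ => sq_nonneg _
    calc _ ≤ 1 * ∫ t in (0 : ℝ)..(k + 1) * M, q.eval t ^ 2 := by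
          gcongr
          exact inv_le_one_of_one_le₀ (by linarith [(Nat.cast_nonneg k : (0 : ℝ) ≤ k)])
      _ ≤ _ := by
          rw [one_mul]
          exact integral_mono_interval le_rfl (by positivity) hkM
            (Filter.Eventually.of_forall fun t => sq_nonneg _) (hcont.intervalIntegrable _ _)
  have hint : M * q.eval 0 ^ 2 ≤
      A * ∑ k ∈ Finset.range (ℓ + 1), ∫ x in (0 : ℝ)..M, q.eval ((k + 1 : ℝ) * x) ^ 2 := by
    rw [← integral_finsetSum fun k _ => Continuous.intervalIntegrable (by fun_prop) _ _,
      ← integral_const_mul]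
    calc M * q.eval 0 ^ 2 = ∫ _ in (0 : ℝ)..M, q.eval 0 ^ 2 := by simp
      _ ≤ _ := integral_mono_on hM0.le (by simp) (Continuous.intervalIntegrable (by fun_prop) _ _)
          fun x _ => h q hq x
  have hle := Finset.sum_le_sum hterm
  rw [Finset.sum_const, Finset.card_range, nsmul_eq_mul] at hle
  push_cast at hle
  calc L * q.eval 0 ^ 2 = (ℓ + 1) * (M * q.eval 0 ^ 2) := by rw [hM]; field_simp
    _ ≤ (ℓ + 1) * (A * ((ℓ + 1) * ∫ t in (0 : ℝ)..L, q.eval t ^ 2)) := by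
        exact mul_le_mul_of_nonneg_left
          (hint.trans (mul_le_mul_of_nonneg_left hle hA.le)) hn.le
    _ = _ := by ring

/-- The divided difference of a polynomial extends continuously to the diagonal. -/
theorem Polynomial.exists_continuous_divided_difference (p : Polynomial ℝ) :
    ∃ g : ℝ → ℝ → ℝ, Continuous (Function.uncurry g) ∧
      ∀ s t, p.eval s - p.eval t = (s - t) * g s t := by
  induction p using Polynomial.induction_on' with
  | add p q hp hq =>
    obtain ⟨g, hg, hgp⟩ := hp
    obtain ⟨k, hk, hkq⟩ := hq
    refine ⟨fun s t => g s t + k s t, hg.add hk, fun s t => ?_⟩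
    rw [eval_add, eval_add, mul_add, ← hgp, ← hkq]
    ring
  | monomial n a =>
    refine ⟨fun s t => a * ∑ i ∈ Finset.range n, s ^ i * t ^ (n - 1 - i), ?_, fun s t => ?_⟩
    · simp only [Function.uncurry_def]
      fun_prop
    · rw [eval_monomial, eval_monomial, ← mul_sub, ← (Commute.all s t).mul_geom_sum₂]
      ring

/-- Fractional Poincaré inequality of order `1/2` for polynomials on an interval. -/
theorem Polynomial.integral_sub_mean_sq_le_gagliardo (p : Polynomial ℝ) {L : ℝ} (hL : 0 < L) :
    ∫ s in (0 : ℝ)..L, (p.eval s - L⁻¹ * ∫ t in (0 : ℝ)..L, p.eval t) ^ 2 ≤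
      L * ∫ s in Set.Ioo (0 : ℝ) L, ∫ t in Set.Ioo (0 : ℝ) L,
        (p.eval s - p.eval t) ^ 2 / (s - t) ^ 2 := by
  obtain ⟨g, hg, hgp⟩ := p.exists_continuous_divided_difference
  set m : ℝ := L⁻¹ * ∫ t in (0 : ℝ)..L, p.eval t with hm
  have hg2 : Continuous (Function.uncurry fun s t => g s t ^ 2) := hg.pow 2
  have hgs : ∀ s, Continuous fun t => g s t ^ 2 := fun s => hg2.comp (Continuous.prodMk_right s)
  have hkernel : ∀ s, ∫ t in Set.Ioo (0 : ℝ) L, (p.eval s - p.eval t) ^ 2 / (s - t) ^ 2 =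
      ∫ t in (0 : ℝ)..L, g s t ^ 2 := by
    intro s
    rw [integral_of_le hL.le, MeasureTheory.integral_Ioc_eq_integral_Ioo]
    refine MeasureTheory.setIntegral_congr_ae measurableSet_Ioo ?_
    filter_upwards [MeasureTheory.Measure.ae_ne MeasureTheory.volume s] with t ht _
    rw [hgp, mul_pow, mul_div_cancel_left₀ _ (pow_ne_zero 2 (sub_ne_zero.mpr ht.symm))]
  simp_rw [hkernel]
  rw [← MeasureTheory.integral_Ioc_eq_integral_Ioo, ← integral_of_le hL.le, ← integral_const_mul]
  refine integral_mono_on hL.le (Continuous.intervalIntegrable (by fun_prop) _ _)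
    (((continuous_parametric_intervalIntegral_of_continuous' hg2 0 L).const_mul
      L).intervalIntegrable _ _) fun s hs => ?_
  have hmean : ∫ t in (0 : ℝ)..L, ((p.eval s - m) ^ 2 - 2 * (p.eval s - m) * (p.eval t - m)) =
      L * (p.eval s - m) ^ 2 := by
    rw [integral_sub (by simp) (Continuous.intervalIntegrable (by fun_prop) _ _),
      integral_const_mul, integral_sub (Continuous.intervalIntegrable (by fun_prop) _ _) (by simp),
      integral_const, integral_const, hm]
    simp only [smul_eq_mul, sub_zero]
    rw [mul_inv_cancel_left₀ hL.ne']
    ring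
  have hmono : ∫ t in (0 : ℝ)..L, ((p.eval s - m) ^ 2 - 2 * (p.eval s - m) * (p.eval t - m)) ≤
      ∫ t in (0 : ℝ)..L, L ^ 2 * g s t ^ 2 := by
    refine integral_mono_on hL.le (Continuous.intervalIntegrable (by fun_prop) _ _)
      (((hgs s).const_mul _).intervalIntegrable _ _) fun t ht => ?_
    have hst : (s - t) ^ 2 ≤ L ^ 2 := by
      exact sq_le_sq' (by linarith [hs.1, ht.2]) (by linarith [hs.2, ht.1])
    calc _ ≤ (p.eval s - p.eval t) ^ 2 := by nlinarith [sq_nonneg (p.eval t - m)]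
      _ = (s - t) ^ 2 * g s t ^ 2 := by rw [hgp, mul_pow]
      _ ≤ _ := by gcongr
  rw [hmean, integral_const_mul, sq L, mul_assoc] at hmono
  exact le_of_mul_le_mul_left hmono hL

/-- Nodal value minus mean value bounded by the Gagliardo `H^{1/2}`-seminorm,
uniformly in the interval length: for each degree bound `ℓ` there is `C > 0`
(depending only on `ℓ`) such that for every `L > 0` and every real polynomial `p`
of degree at most `ℓ`,
`|p(0) - L⁻¹ ∫₀^L p|² ≤ C ∫₀^L ∫₀^L (p(s) - p(t))²/(s - t)² ds dt`. -/
theorem poly_nodal_minus_mean_le_gagliardo (ℓ : ℕ) :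
    ∃ C > (0 : ℝ), ∀ L > (0 : ℝ), ∀ p : Polynomial ℝ, p.natDegree ≤ ℓ →
      (p.eval 0 - L⁻¹ * ∫ t in (0 : ℝ)..L, p.eval t) ^ 2 ≤
        C * ∫ s in Set.Ioo (0 : ℝ) L, ∫ t in Set.Ioo (0 : ℝ) L,
          (p.eval s - p.eval t) ^ 2 / (s - t) ^ 2 := by
  obtain ⟨A, hA, htrace⟩ := Polynomial.exists_mul_sq_eval_zero_le_integral ℓ
  refine ⟨A, hA, fun L hL p hp => ?_⟩
  have h := htrace L hL (p - Polynomial.C (L⁻¹ * ∫ t in (0 : ℝ)..L, p.eval t))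
    ((Polynomial.natDegree_sub_C).trans_le hp)
  simp only [Polynomial.eval_sub, Polynomial.eval_C] at h
  have h' := h.trans (mul_le_mul_of_nonneg_left (p.integral_sub_mean_sq_le_gagliardo hL) hA.le)
  rw [mul_left_comm] at h'
  exact le_of_mul_le_mul_left h' hL
end

section
/- Let Ω₋ = (−1,1)² \ [0,1]² be the L-shaped region and Ω₊ = (0,1) × (0,1). Let v : ℝ² → ℝ be continuously differentiable on an open neighborhood of the closure of Ω₋, and define w on Ω₊ by w(x,y) = v(−x,y) + v(x,−y) − v(−x,−y). Then ∫_{Ω₊} |∇w(x,y)|² dx dy ≤ 3 · ∫_{Ω₋} |∇v(x,y)|² dx dy, where |∇w|² = (∂w/∂x)² + (∂w/∂y)². Consequently, for μ < 0, ∫_{Ω₊} |∇w|² ≤ (3/|μ|) · |∫_{Ω₋} μ |∇v|²|. -/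
open MeasureTheory

/-- The squared Euclidean norm of the gradient of a function on the plane. -/
noncomputable def gradSq (v : ℝ × ℝ → ℝ) (p : ℝ × ℝ) : ℝ :=
  (fderiv ℝ v p (1, 0)) ^ 2 + (fderiv ℝ v p (0, 1)) ^ 2

/-- The energy density of the sum of three reflections is at most three times the sum of the
reflected energy densities. -/
lemma gradSq_reflections_le {v : ℝ × ℝ → ℝ} {p : ℝ × ℝ}
    (h₁ : DifferentiableAt ℝ v (-p.1, p.2)) (h₂ : DifferentiableAt ℝ v (p.1, -p.2))
    (h₃ : DifferentiableAt ℝ v (-p.1, -p.2)) :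
    gradSq (fun q : ℝ × ℝ => v (-q.1, q.2) + v (q.1, -q.2) - v (-q.1, -q.2)) p ≤
      3 * (gradSq v (-p.1, p.2) + gradSq v (p.1, -p.2) + gradSq v (-p.1, -p.2)) := by
  have hfst : HasFDerivAt (fun q : ℝ × ℝ => q.1) (ContinuousLinearMap.fst ℝ ℝ ℝ) p :=
    hasFDerivAt_fst
  have hsnd : HasFDerivAt (fun q : ℝ × ℝ => q.2) (ContinuousLinearMap.snd ℝ ℝ ℝ) p :=
    hasFDerivAt_snd
  have d₁ := HasFDerivAt.comp (f := fun q : ℝ × ℝ => (-q.1, q.2)) p h₁.hasFDerivAt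
    (hfst.neg.prodMk hsnd)
  have d₂ := HasFDerivAt.comp (f := fun q : ℝ × ℝ => (q.1, -q.2)) p h₂.hasFDerivAt
    (hfst.prodMk hsnd.neg)
  have d₃ := HasFDerivAt.comp (f := fun q : ℝ × ℝ => (-q.1, -q.2)) p h₃.hasFDerivAt
    (hfst.neg.prodMk hsnd.neg)
  have hw : fderiv ℝ (fun q : ℝ × ℝ => v (-q.1, q.2) + v (q.1, -q.2) - v (-q.1, -q.2)) p = _ :=
    ((d₁.add d₂).sub d₃).fderiv
  have neg_fst (L : ℝ × ℝ →L[ℝ] ℝ) : L (-1, 0) = -L (1, 0) := by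
    rw [← map_neg]; simp
  have neg_snd (L : ℝ × ℝ →L[ℝ] ℝ) : L (0, -1) = -L (0, 1) := by
    rw [← map_neg]; simp
  have three (a b c : ℝ) : (a + b + c) ^ 2 ≤ 3 * (a ^ 2 + b ^ 2 + c ^ 2) := by
    nlinarith [sq_nonneg (a - b), sq_nonneg (b - c), sq_nonneg (a - c)]
  have hx := three (-fderiv ℝ v (-p.1, p.2) (1, 0)) (fderiv ℝ v (p.1, -p.2) (1, 0))
    (fderiv ℝ v (-p.1, -p.2) (1, 0))
  have hy := three (fderiv ℝ v (-p.1, p.2) (0, 1)) (-fderiv ℝ v (p.1, -p.2) (0, 1))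
    (fderiv ℝ v (-p.1, -p.2) (0, 1))
  simp only [gradSq, hw]
  simp [neg_fst, neg_snd]
  linarith

/-- A measure preserving, measurably embedded change of variables on a set. -/
lemma integrableOn_comp_and_setIntegral_comp {T : ℝ × ℝ → ℝ × ℝ}
    (hT : MeasurePreserving T) (hTe : MeasurableEmbedding T) {f : ℝ × ℝ → ℝ}
    {s t : Set (ℝ × ℝ)} (hst : T ⁻¹' t = s) (hf : IntegrableOn f t) :
    IntegrableOn (fun p => f (T p)) s ∧ ∫ p in s, f (T p) = ∫ p in t, f p := by
  subst hst
  exact ⟨(hT.integrableOn_comp_preimage hTe).2 hf, hT.setIntegral_preimage_emb hTe f t⟩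

/-- The integral of a nonnegative function over the open unit square, summed over the three
reflections of the square into the L-shaped region, is at most its integral over that region. -/
lemma integrableOn_reflections_and_setIntegral_le {f : ℝ × ℝ → ℝ} (hf₀ : ∀ p, 0 ≤ f p)
    (hf : IntegrableOn f ((Set.Ioo (-1 : ℝ) 1 ×ˢ Set.Ioo (-1 : ℝ) 1) \
      (Set.Icc (0 : ℝ) 1 ×ˢ Set.Icc (0 : ℝ) 1))) :
    IntegrableOn (fun p => f (-p.1, p.2) + f (p.1, -p.2) + f (-p.1, -p.2))
      (Set.Ioo (0 : ℝ) 1 ×ˢ Set.Ioo (0 : ℝ) 1) ∧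
    ∫ p in Set.Ioo (0 : ℝ) 1 ×ˢ Set.Ioo (0 : ℝ) 1,
      (f (-p.1, p.2) + f (p.1, -p.2) + f (-p.1, -p.2)) ≤
      ∫ p in (Set.Ioo (-1 : ℝ) 1 ×ˢ Set.Ioo (-1 : ℝ) 1) \
        (Set.Icc (0 : ℝ) 1 ×ˢ Set.Icc (0 : ℝ) 1), f p := by
  set S := (Set.Ioo (-1 : ℝ) 1 ×ˢ Set.Ioo (-1 : ℝ) 1) \
    (Set.Icc (0 : ℝ) 1 ×ˢ Set.Icc (0 : ℝ) 1) with hS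
  set A := Set.Ioo (-1 : ℝ) 0 ×ˢ Set.Ioo (0 : ℝ) 1 with hA
  set B := Set.Ioo (0 : ℝ) 1 ×ˢ Set.Ioo (-1 : ℝ) 0 with hB
  set C := Set.Ioo (-1 : ℝ) 0 ×ˢ Set.Ioo (-1 : ℝ) 0 with hC
  have hsub : A ∪ B ∪ C ⊆ S := by
    rintro ⟨x, y⟩ h
    simp only [hA, hB, hC, hS, Set.mem_union, Set.mem_sdiff, Set.mem_prod, Set.mem_Ioo,
      Set.mem_Icc] at h ⊢
    grind
  have hAB : Disjoint A B := by
    rw [Set.disjoint_left]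
    rintro ⟨x, y⟩ h h'
    simp only [hA, hB, Set.mem_prod, Set.mem_Ioo] at h h'
    linarith [h.1.2, h'.1.1]
  have hABC : Disjoint (A ∪ B) C := by
    rw [Set.disjoint_left]
    rintro ⟨x, y⟩ h h'
    simp only [hA, hB, hC, Set.mem_union, Set.mem_prod, Set.mem_Ioo] at h h'
    grind
  have mB : MeasurableSet B := measurableSet_Ioo.prod measurableSet_Ioo
  have mC : MeasurableSet C := measurableSet_Ioo.prod measurableSet_Ioo
  have iAB : IntegrableOn f (A ∪ B) := hf.mono_set (Set.subset_union_left.trans hsub)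
  have iA : IntegrableOn f A := iAB.mono_set Set.subset_union_left
  have iB : IntegrableOn f B := iAB.mono_set Set.subset_union_right
  have iC : IntegrableOn f C := hf.mono_set (Set.subset_union_right.trans hsub)
  have hneg := Measure.measurePreserving_neg (volume : Measure ℝ)
  have hid := MeasurePreserving.id (volume : Measure ℝ)
  obtain ⟨jA, eA⟩ := integrableOn_comp_and_setIntegral_comp
    (T := fun p => (-p.1, p.2)) (s := Set.Ioo (0 : ℝ) 1 ×ˢ Set.Ioo (0 : ℝ) 1) (hneg.prod hid)
    ((MeasurableEquiv.neg ℝ).prodCongr (MeasurableEquiv.refl ℝ)).measurableEmbedding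
    (by ext ⟨x, y⟩; simp [hA]; grind) iA
  obtain ⟨jB, eB⟩ := integrableOn_comp_and_setIntegral_comp
    (T := fun p => (p.1, -p.2)) (s := Set.Ioo (0 : ℝ) 1 ×ˢ Set.Ioo (0 : ℝ) 1) (hid.prod hneg)
    ((MeasurableEquiv.refl ℝ).prodCongr (MeasurableEquiv.neg ℝ)).measurableEmbedding
    (by ext ⟨x, y⟩; simp [hB]; grind) iB
  obtain ⟨jC, eC⟩ := integrableOn_comp_and_setIntegral_comp
    (T := fun p => (-p.1, -p.2)) (s := Set.Ioo (0 : ℝ) 1 ×ˢ Set.Ioo (0 : ℝ) 1) (hneg.prod hneg)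
    ((MeasurableEquiv.neg ℝ).prodCongr (MeasurableEquiv.neg ℝ)).measurableEmbedding
    (by ext ⟨x, y⟩; simp [hC]; grind) iC
  have jAB : IntegrableOn (fun p => f (-p.1, p.2) + f (p.1, -p.2))
      (Set.Ioo (0 : ℝ) 1 ×ˢ Set.Ioo (0 : ℝ) 1) := jA.add jB
  refine ⟨jAB.add jC, ?_⟩
  rw [integral_add jAB jC, integral_add jA jB, eA, eB, eC,
    ← setIntegral_union hAB mB iA iB, ← setIntegral_union hABC mC iAB iC]
  exact setIntegral_mono_set hf (ae_of_all _ hf₀) hsub.eventuallyLE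

/-- Extension from the L-shaped region `Ω₋ = (-1,1)² \ [0,1]²` to the square
`Ω₊ = (0,1)²`: for `v` of class `C¹` on an open neighborhood of the closure of
`Ω₋` and `w(x,y) = v(-x,y) + v(x,-y) - v(-x,-y)` on `Ω₊`, one has
`∫_{Ω₊} |∇w|² ≤ 3 ∫_{Ω₋} |∇v|²`; hence for `μ < 0`,
`∫_{Ω₊} |∇w|² ≤ (3/|μ|) |∫_{Ω₋} μ |∇v|²|`. -/
theorem extension_from_Lshape_energy
    (v : ℝ × ℝ → ℝ) (U : Set (ℝ × ℝ)) (hU : IsOpen U)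
    (hcl : closure ((Set.Ioo (-1 : ℝ) 1 ×ˢ Set.Ioo (-1 : ℝ) 1) \
        (Set.Icc (0 : ℝ) 1 ×ˢ Set.Icc (0 : ℝ) 1)) ⊆ U)
    (hv : ContDiffOn ℝ 1 v U) (μ : ℝ) (hμ : μ < 0) :
    (∫ p in Set.Ioo (0 : ℝ) 1 ×ˢ Set.Ioo (0 : ℝ) 1,
        ((fderiv ℝ (fun q : ℝ × ℝ => v (-q.1, q.2) + v (q.1, -q.2) - v (-q.1, -q.2)) p (1, 0)) ^ 2 +
         (fderiv ℝ (fun q : ℝ × ℝ => v (-q.1, q.2) + v (q.1, -q.2) - v (-q.1, -q.2)) p (0, 1)) ^ 2)) ≤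
      3 * ∫ p in (Set.Ioo (-1 : ℝ) 1 ×ˢ Set.Ioo (-1 : ℝ) 1) \
            (Set.Icc (0 : ℝ) 1 ×ˢ Set.Icc (0 : ℝ) 1),
        ((fderiv ℝ v p (1, 0)) ^ 2 + (fderiv ℝ v p (0, 1)) ^ 2) ∧
    (∫ p in Set.Ioo (0 : ℝ) 1 ×ˢ Set.Ioo (0 : ℝ) 1,
        ((fderiv ℝ (fun q : ℝ × ℝ => v (-q.1, q.2) + v (q.1, -q.2) - v (-q.1, -q.2)) p (1, 0)) ^ 2 +
         (fderiv ℝ (fun q : ℝ × ℝ => v (-q.1, q.2) + v (q.1, -q.2) - v (-q.1, -q.2)) p (0, 1)) ^ 2)) ≤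
      (3 / |μ|) * |∫ p in (Set.Ioo (-1 : ℝ) 1 ×ˢ Set.Ioo (-1 : ℝ) 1) \
            (Set.Icc (0 : ℝ) 1 ×ˢ Set.Icc (0 : ℝ) 1),
        μ * ((fderiv ℝ v p (1, 0)) ^ 2 + (fderiv ℝ v p (0, 1)) ^ 2)| := by
  set S := (Set.Ioo (-1 : ℝ) 1 ×ˢ Set.Ioo (-1 : ℝ) 1) \
    (Set.Icc (0 : ℝ) 1 ×ˢ Set.Icc (0 : ℝ) 1) with hS
  have hg₀ (u : ℝ × ℝ → ℝ) (p : ℝ × ℝ) : 0 ≤ gradSq u p := by unfold gradSq; positivity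
  have hcompact : IsCompact (closure S) :=
    (((Metric.isBounded_Ioo _ _).prod (Metric.isBounded_Ioo _ _)).subset
      Set.sdiff_subset).isCompact_closure
  have hderiv : ContinuousOn (fderiv ℝ v) U := hv.continuousOn_fderiv_of_isOpen hU le_rfl
  have hcont : ContinuousOn (gradSq v) U :=
    ((hderiv.clm_apply continuousOn_const).pow 2).add
      ((hderiv.clm_apply continuousOn_const).pow 2)
  have hint : IntegrableOn (gradSq v) S :=
    ((hcont.mono hcl).integrableOn_compact hcompact).mono_set subset_closure
  have hdiff {p : ℝ × ℝ} (hp : p ∈ S) : DifferentiableAt ℝ v p :=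
    (hv.differentiableOn one_ne_zero).differentiableAt (hU.mem_nhds (hcl (subset_closure hp)))
  obtain ⟨hrefl, hle⟩ := integrableOn_reflections_and_setIntegral_le (hg₀ v) hint
  have key : ∫ p in Set.Ioo (0 : ℝ) 1 ×ˢ Set.Ioo (0 : ℝ) 1,
      gradSq (fun q : ℝ × ℝ => v (-q.1, q.2) + v (q.1, -q.2) - v (-q.1, -q.2)) p ≤
        3 * ∫ p in S, gradSq v p := by
    refine le_trans (integral_mono_of_nonneg (ae_of_all _ (hg₀ _)) (hrefl.const_mul 3) ?_)
      ((integral_const_mul _ _).trans_le (mul_le_mul_of_nonneg_left hle (by norm_num)))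
    filter_upwards [ae_restrict_mem (measurableSet_Ioo.prod measurableSet_Ioo)] with p hp
    simp only [Set.mem_prod, Set.mem_Ioo] at hp
    apply gradSq_reflections_le <;> apply hdiff <;>
      simp only [hS, Set.mem_sdiff, Set.mem_prod, Set.mem_Ioo, Set.mem_Icc] <;> grind
  refine ⟨key, key.trans_eq ?_⟩
  change _ = 3 / |μ| * |∫ p in S, μ * gradSq v p|
  rw [integral_const_mul, abs_mul, abs_of_nonneg (integral_nonneg (hg₀ v))]
  have := abs_pos.2 hμ.ne
  field_simp
end
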